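/- Let z : ℕ → Σ₃ be an infinite word containing no factor of exponent 5/2 or greater, and suppose a final segment of z equals h(u) for some infinite word u : ℕ → Σ₃, where h = [a,b,c] with a, b, c nonempty finite words satisfying: (1) b is a suffix of a and a is a suffix of c; (2) |b| ≥ |c|/2; (3) b and c have a common prefix p with |p| ≥ |b|/2. Then L(z)^R ⊇ L(h^R(G)). -/

import Mathlib

/-! Common definitions: the alphabet Σ₃, finite and infinite words, factors,
factor complexity, periods and exponents, morphisms, the morphism γ and its
fixed point G = γ^ω(0). -/

abbrev Sigma3 := Fin 3
abbrev Word := List Sigma3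
abbrev InfWord := ℕ → Sigma3

/-- `u` is a factor of the infinite word `w`. -/
def IsFactor (u : Word) (w : InfWord) : Prop :=
  ∃ i : ℕ, u = (List.range u.length).map (fun j => w (i + j))

/-- The set of finite factors of `w`. -/
def Lang (w : InfWord) : Set Word := {u | IsFactor u w}

/-- Factor complexity: the number of distinct length-`n` factors of `w`. -/
noncomputable def complexity (w : InfWord) (n : ℕ) : ℕ :=
  Set.ncard {u : Word | IsFactor u w ∧ u.length = n}

/-- `v` has period `p` (with `p ≥ 1`). -/
def HasPeriod (v : Word) (p : ℕ) : Prop :=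
  1 ≤ p ∧ ∀ i, i + p < v.length → v.getD i 0 = v.getD (i + p) 0

/-- The least period of `v`. -/
noncomputable def minPeriod (v : Word) : ℕ := sInf {p | HasPeriod v p}

/-- The exponent `|v| / p` of a nonempty finite word `v`, where `p` is its least period. -/
noncomputable def expo (v : Word) : ℝ := (v.length : ℝ) / (minPeriod v : ℝ)

/-- `w` contains no factor of exponent `5/2` or greater. -/
def NoFiveHalves (w : InfWord) : Prop :=
  ∀ u : Word, u ≠ [] → IsFactor u w → expo u < 5 / 2

/-- Apply a morphism (given by the images of the three letters) to a finite word. -/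
def applyM (f : Sigma3 → Word) (u : Word) : Word := (u.map f).flatten

/-- The image under `f` of the length-`k` prefix of the infinite word `u`. -/
def imPrefix (f : Sigma3 → Word) (u : InfWord) (k : ℕ) : Word :=
  applyM f ((List.range k).map u)

/-- The image of an infinite word under a (non-erasing) morphism. -/
def applyMInf (f : Sigma3 → Word) (u : InfWord) : InfWord :=
  fun n => (imPrefix f u (n + 1)).getD n 0

/-- The morphism `γ = [01, 2, 02]`. -/
def gam : Sigma3 → Word := ![[0, 1], [2], [0, 2]]

/-- The fixed point `G = γ^ω(0)` of `γ`, the unique infinite fixed point beginning with 0. -/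
def G : InfWord := fun n => ((applyM gam)^[n + 1] [0]).getD n 0

/-- The final segment of `w` starting at position `k`. -/
def shift (w : InfWord) (k : ℕ) : InfWord := fun i => w (i + k)

/-- The reverse `h^R` of a morphism `h`. -/
def mR (f : Sigma3 → Word) : Sigma3 → Word := fun x => (f x).reverse

/-- The prefix of length `n` of an infinite word. -/
def prefixOf (w : InfWord) (n : ℕ) : Word := (List.range n).map w

@[simp] lemma length_prefixOf (w : InfWord) (n : ℕ) : (prefixOf w n).length = n := by
  simp [prefixOf]

lemma prefixOf_isPrefix (w : InfWord) {m n : ℕ} (h : m ≤ n) : prefixOf w m <+: prefixOf w n := by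
  obtain ⟨d, rfl⟩ := Nat.exists_eq_add_of_le h
  simp [prefixOf, List.range_add]

lemma isFactor_iff (v : Word) (w : InfWord) : IsFactor v w ↔ ∃ n, v <:+: prefixOf w n := by
  constructor
  · rintro ⟨i, hi⟩
    refine ⟨i + v.length, prefixOf w i, [], ?_⟩
    rw [List.append_nil, prefixOf, prefixOf, List.range_add, List.map_append, List.map_map]
    exact congrArg _ hi
  · rintro ⟨n, s, t, h⟩
    refine ⟨s.length, List.ext_getElem (by simp) fun j hj _ => ?_⟩
    have hn : s.length + j < n := by
      have := congrArg List.length h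
      simp at this
      omega
    have h2 : (s ++ v ++ t)[s.length + j]? = (prefixOf w n)[s.length + j]? := by rw [h]
    rw [List.append_assoc, List.getElem?_append_right (by omega),
      List.getElem?_append_left (by omega)] at h2
    simpa [prefixOf, hn, hj] using h2

lemma Lang_of_isInfix {w : InfWord} {v v' : Word} (h : v <:+: v') (hv : v' ∈ Lang w) : v ∈ Lang w := by
  obtain ⟨n, hn⟩ := (isFactor_iff _ _).1 hv
  exact (isFactor_iff _ _).2 ⟨n, h.trans hn⟩

lemma Lang_shift {w : InfWord} {k : ℕ} {v : Word} (h : v ∈ Lang (shift w k)) : v ∈ Lang w := by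
  obtain ⟨i, hi⟩ := h
  refine ⟨i + k, hi.trans (List.map_congr_left fun j _ => ?_)⟩
  simp only [shift]
  congr 1
  omega

@[simp] lemma applyM_append (f : Sigma3 → Word) (x y : Word) :
    applyM f (x ++ y) = applyM f x ++ applyM f y := by
  simp [applyM]

@[simp] lemma applyM_nil (f : Sigma3 → Word) : applyM f [] = [] := rfl

@[simp] lemma applyM_cons (f : Sigma3 → Word) (i : Sigma3) (x : Word) :
    applyM f (i :: x) = f i ++ applyM f x := by
  simp [applyM]

lemma applyM_isInfix (f : Sigma3 → Word) {x y : Word} (h : x <:+: y) :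
    applyM f x <:+: applyM f y := by
  obtain ⟨s, t, rfl⟩ := h
  exact ⟨applyM f s, applyM f t, by simp⟩

lemma applyM_isPrefix (f : Sigma3 → Word) {x y : Word} (h : x <+: y) :
    applyM f x <+: applyM f y := by
  obtain ⟨t, rfl⟩ := h
  exact ⟨applyM f t, by simp⟩

lemma applyM_comp (f g : Sigma3 → Word) (x : Word) :
    applyM (fun i => applyM f (g i)) x = applyM f (applyM g x) := by
  induction x with
  | nil => rfl
  | cons i x ih => simp [ih]

lemma reverse_applyM (f : Sigma3 → Word) (x : Word) :
    (applyM f x).reverse = applyM (mR f) x.reverse := by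
  induction x with
  | nil => rfl
  | cons i x ih => simp [ih, mR]

lemma mR_mR (f : Sigma3 → Word) : mR (mR f) = f := by
  funext i
  simp [mR]

lemma length_le_length_applyM {f : Sigma3 → Word} (hf : ∀ i, f i ≠ []) (x : Word) :
    x.length ≤ (applyM f x).length := by
  induction x with
  | nil => simp
  | cons i x ih =>
    have := List.length_pos_of_ne_nil (hf i)
    simp
    omega

lemma getD_eq_of_isPrefix {x y : Word} (h : x <+: y) {i : ℕ} (hi : i < x.length) :
    x.getD i 0 = y.getD i 0 := by
  obtain ⟨t, rfl⟩ := h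
  rw [List.getD_append _ _ _ _ hi]

lemma prefixOf_eq_of_getD {w : InfWord} {x : Word} (h : ∀ i < x.length, w i = x.getD i 0) :
    prefixOf w x.length = x :=
  List.ext_getElem (by simp) fun i _ hi => by
    simp [prefixOf, h i hi, List.getElem?_eq_getElem hi]

lemma prefixOf_applyMInf {f : Sigma3 → Word} (hf : ∀ i, f i ≠ []) (u : InfWord) (n : ℕ) :
    prefixOf (applyMInf f u) (applyM f (prefixOf u n)).length = applyM f (prefixOf u n) := by
  refine prefixOf_eq_of_getD fun i hi => ?_
  have hi' : i < (applyM f (prefixOf u (i + 1))).length := by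
    have := length_le_length_applyM hf (prefixOf u (i + 1))
    simp at this
    omega
  change (applyM f (prefixOf u (i + 1))).getD i 0 = _
  rcases le_total (i + 1) n with h | h
  · exact getD_eq_of_isPrefix (applyM_isPrefix f (prefixOf_isPrefix u h)) hi'
  · exact (getD_eq_of_isPrefix (applyM_isPrefix f (prefixOf_isPrefix u h)) hi).symm

lemma applyM_prefixOf_mem_Lang {f : Sigma3 → Word} (hf : ∀ i, f i ≠ []) (u : InfWord) (n : ℕ) :
    applyM f (prefixOf u n) ∈ Lang (applyMInf f u) :=
  (isFactor_iff _ _).2 ⟨_, by rw [prefixOf_applyMInf hf]⟩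

lemma prefixOf_applyMInf_isPrefix {f : Sigma3 → Word} (hf : ∀ i, f i ≠ []) (u : InfWord) (n : ℕ) :
    prefixOf (applyMInf f u) n <+: applyM f (prefixOf u n) := by
  have h := prefixOf_isPrefix (applyMInf f u) (m := n) (n := (applyM f (prefixOf u n)).length)
    (by simpa using length_le_length_applyM hf (prefixOf u n))
  rwa [prefixOf_applyMInf hf] at h

lemma gam_ne_nil (i : Sigma3) : gam i ≠ [] := by
  fin_cases i <;> simp [gam]

lemma iterate_gam_append (n : ℕ) (x y : Word) :
    (applyM gam)^[n] (x ++ y) = (applyM gam)^[n] x ++ (applyM gam)^[n] y := by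
  induction n generalizing x y with
  | zero => rfl
  | succ n ih => simp [ih]

lemma length_le_length_iterate_gam (n : ℕ) (x : Word) :
    x.length ≤ ((applyM gam)^[n] x).length := by
  induction n with
  | zero => simp
  | succ n ih =>
    rw [Function.iterate_succ_apply']
    exact ih.trans (length_le_length_applyM gam_ne_nil _)

lemma iterate_gam_succ (n : ℕ) :
    (applyM gam)^[n + 1] [0] = (applyM gam)^[n] [0] ++ (applyM gam)^[n] [1] := by
  rw [Function.iterate_succ_apply, ← iterate_gam_append]
  rfl

lemma lt_length_iterate_gam (n : ℕ) : n < ((applyM gam)^[n] [0]).length := by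
  induction n with
  | zero => simp
  | succ n ih =>
    have := length_le_length_iterate_gam n [1]
    rw [iterate_gam_succ, List.length_append]
    simp at this
    omega

lemma iterate_gam_isPrefix {m n : ℕ} (h : m ≤ n) :
    (applyM gam)^[m] [0] <+: (applyM gam)^[n] [0] := by
  induction n, h using Nat.le_induction with
  | base => exact List.prefix_refl _
  | succ n _ ih => exact ih.trans (iterate_gam_succ n ▸ List.prefix_append _ _)

lemma prefixOf_G_isPrefix (n : ℕ) : prefixOf G n <+: (applyM gam)^[n] [0] := by
  have h : prefixOf G ((applyM gam)^[n] [0]).length = (applyM gam)^[n] [0] := by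
    refine prefixOf_eq_of_getD fun i hi => ?_
    have hi' : i < ((applyM gam)^[i + 1] [0]).length := by
      have := lt_length_iterate_gam (i + 1)
      omega
    rcases le_total (i + 1) n with h | h
    · exact getD_eq_of_isPrefix (iterate_gam_isPrefix h) hi'
    · exact (getD_eq_of_isPrefix (iterate_gam_isPrefix h) hi).symm
  exact h ▸ prefixOf_isPrefix G (lt_length_iterate_gam n).le

lemma reverse_iterate_gam (n : ℕ) (x : Word) :
    ((applyM gam)^[n] x).reverse = (applyM (mR gam))^[n] x.reverse := by
  induction n with
  | zero => rfl
  | succ n ih => rw [Function.iterate_succ_apply', Function.iterate_succ_apply',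
      reverse_applyM, ih]

lemma iterate_applyM_isInfix (f : Sigma3 → Word) (n : ℕ) {x y : Word} (h : x <:+: y) :
    (applyM f)^[n] x <:+: (applyM f)^[n] y := by
  induction n with
  | zero => exact h
  | succ n ih =>
    rw [Function.iterate_succ_apply', Function.iterate_succ_apply']
    exact applyM_isInfix f ih

lemma hasPeriod_of_isPrefix {v y : Word} (hy : y ≠ []) (h : v <+: y ++ v) :
    HasPeriod v y.length := by
  refine ⟨List.length_pos_of_ne_nil hy, fun i hi => ?_⟩
  rw [getD_eq_of_isPrefix h hi, List.getD_append_right _ _ _ _ (by omega)]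
  simp

lemma five_halves_le_expo {v : Word} {n : ℕ} (h : HasPeriod v n) (hn : 5 * n ≤ 2 * v.length) :
    5 / 2 ≤ expo v := by
  have hmem : HasPeriod v (minPeriod v) := Nat.sInf_mem (s := {p | HasPeriod v p}) ⟨n, h⟩
  have hle : minPeriod v ≤ n := Nat.sInf_le h
  have hpos : (0 : ℝ) < minPeriod v := by exact_mod_cast hmem.1
  rw [expo, le_div_iff₀ hpos]
  have h1 : (5 * minPeriod v : ℝ) ≤ 2 * v.length := by exact_mod_cast (by omega)
  linarith

/-- A square `x x`, extended to the left by a suffix of `x` and to the right by a prefix of `x`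
of total length at least `|x| / 2`, has exponent at least `5/2`. -/
lemma extended_square_not_mem_Lang {z : InfWord} (hz : NoFiveHalves z) {s x q : Word}
    (hx : x ≠ []) (hs : s <:+ x) (hq : q <+: x) (hlen : x.length ≤ 2 * (s.length + q.length)) :
    s ++ x ++ x ++ q ∉ Lang z := by
  intro hmem
  have hne : s ++ x ++ x ++ q ≠ [] := by simp [hx]
  refine (hz _ hne hmem).not_ge ?_
  obtain ⟨e, rfl⟩ := hs
  obtain ⟨d, hd⟩ := hq
  refine five_halves_le_expo (n := (s ++ e).length)
    (hasPeriod_of_isPrefix (by simpa [and_comm] using hx) ⟨d ++ q, ?_⟩) ?_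
  · have : e ++ (s ++ q) = q ++ (d ++ q) := by
      rw [← List.append_assoc, ← hd, List.append_assoc]
    simp only [List.append_assoc, ← this]
  · simp at hlen ⊢
    omega

/-- Conditions on a morphism ensuring that squares of letters, inside a longer word, have images
that extend to powers of exponent at least `5/2`; they are inherited by the composition with
`γ^R` on the right. -/
structure SquareExtending (f : Sigma3 → Word) (s t q r : Word) : Prop where
  ne_nil : ∀ i, f i ≠ []
  suffix_all : ∀ i, s <:+ f i
  suffix_zero : t <:+ f 0
  suffix_two : t <:+ f 2
  prefix_all : ∀ i, q <+: f i
  prefix_one : r <+: f 1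
  prefix_two : r <+: f 2
  length_le : ∀ i, (f i).length ≤ (f 2).length
  length_two_le : (f 2).length ≤ 2 * (s.length + q.length)
  length_two_add_le : (f 2).length + (f 0).length ≤ 2 * (t.length + r.length)

namespace SquareExtending

variable {f : Sigma3 → Word} {s t q r : Word}

lemma comp (h : SquareExtending f s t q r) :
    SquareExtending (fun i => applyM f (mR gam i)) t (s ++ f 0) r (f 2) := by
  have h0 : applyM f (mR gam 0) = f 1 ++ f 0 := by simp [mR, gam]
  have h1 : applyM f (mR gam 1) = f 2 := by simp [mR, gam]
  have h2 : applyM f (mR gam 2) = f 2 ++ f 0 := by simp [mR, gam]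
  have l0 := h.length_le 0
  have l1 := h.length_le 1
  have l2 := h.length_two_le
  have l3 := h.length_two_add_le
  constructor <;> try simp only [Fin.forall_fin_succ, Fin.succ_zero_eq_one, Fin.succ_one_eq_two,
    IsEmpty.forall_iff, and_true, h0, h1, h2, List.length_append]
  · simp [h.ne_nil]
  · exact ⟨h.suffix_zero.trans (List.suffix_append _ _), h.suffix_two,
      h.suffix_zero.trans (List.suffix_append _ _)⟩
  · obtain ⟨d, hd⟩ := h.suffix_all 1
    exact ⟨d, by simp [← hd]⟩
  · obtain ⟨d, hd⟩ := h.suffix_all 2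
    exact ⟨d, by simp [← hd]⟩
  · exact ⟨h.prefix_one.trans (List.prefix_append _ _), h.prefix_two,
      h.prefix_two.trans (List.prefix_append _ _)⟩
  · exact List.prefix_refl _
  · exact List.prefix_append _ _
  · omega
  · omega
  · omega

lemma ne_of_mem (h : SquareExtending f s t q r) {z : InfWord} (hz : NoFiveHalves z)
    {y i j y' : Sigma3} (hmem : applyM f [y, i, j, y'] ∈ Lang z) : i ≠ j := by
  rintro rfl
  have hi := h.length_le i
  have h2 := h.length_two_le
  refine extended_square_not_mem_Lang hz (h.ne_nil i) (h.suffix_all i) (h.prefix_all i) (by omega)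
    (Lang_of_isInfix ?_ hmem)
  obtain ⟨d, hd⟩ := h.suffix_all y
  obtain ⟨e, he⟩ := h.prefix_all y'
  exact ⟨d, e, by simp [← hd, ← he]⟩

end SquareExtending

/-- The two-letter words other than `00`, `11`, `22`, `12`. -/
def Allowed (i j : Sigma3) : Prop := i ≠ j ∧ ¬(i = 1 ∧ j = 2)

lemma exists_applyM_of_isChain : ∀ x : Word, x.IsChain Allowed → x.head? ≠ some 0 →
    ∃ x' e : Word, e.length ≤ 1 ∧ x = applyM (mR gam) x' ++ e
  | [], _, _ => ⟨[], [], by simp⟩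
  | 0 :: _, _, h => absurd rfl h
  | [1], _, _ => ⟨[], [1], by simp⟩
  | 1 :: 1 :: _, h, _ => absurd rfl (List.isChain_cons_cons.1 h).1.1
  | 1 :: 2 :: _, h, _ => absurd ⟨rfl, rfl⟩ (List.isChain_cons_cons.1 h).1.2
  | 1 :: 0 :: x, h, _ => by
    obtain ⟨x', e, he, rfl⟩ := exists_applyM_of_isChain x h.tail.tail (by
      intro h0
      cases x with
      | nil => simp at h0
      | cons i x => simp at h0; subst h0; exact (List.isChain_cons_cons.1 h.tail).1.1 rfl)
    exact ⟨0 :: x', e, he, by simp [mR, gam]⟩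
  | 2 :: 0 :: x, h, _ => by
    obtain ⟨x', e, he, rfl⟩ := exists_applyM_of_isChain x h.tail.tail (by
      intro h0
      cases x with
      | nil => simp at h0
      | cons i x => simp at h0; subst h0; exact (List.isChain_cons_cons.1 h.tail).1.1 rfl)
    exact ⟨2 :: x', e, he, by simp [mR, gam]⟩
  | [2], _, _ => ⟨[1], [], by simp [mR, gam]⟩
  | 2 :: 1 :: x, h, _ => by
    obtain ⟨x', e, he, hx⟩ := exists_applyM_of_isChain (1 :: x) h.tail (by simp)
    exact ⟨1 :: x', e, he, by simp [mR, gam, hx]⟩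
  | 2 :: 2 :: _, h, _ => absurd rfl (List.isChain_cons_cons.1 h).1.1

lemma isChain_allowed_of_mem {f : Sigma3 → Word} {s t q r : Word}
    (h : SquareExtending f s t q r) {z : InfWord} (hz : NoFiveHalves z) {x : Word}
    {y y' : Sigma3} (hx : (y :: x ++ [y']).IsChain fun i j => ¬(i = 1 ∧ j = 2))
    (hmem : applyM f (y :: x ++ [y']) ∈ Lang z) : x.IsChain Allowed := by
  rw [List.isChain_iff_forall_rel_of_append_cons_cons] at hx ⊢
  rintro i j l₁ l₂ rfl
  refine ⟨?_, hx (l₁ := y :: l₁) (l₂ := l₂ ++ [y']) (by simp)⟩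
  obtain ⟨m, w, hw⟩ : ∃ m w, y :: l₁ = m ++ [w] :=
    ⟨_, _, (List.dropLast_append_getLast (List.cons_ne_nil y l₁)).symm⟩
  obtain ⟨w', m', hw'⟩ : ∃ w' m', l₂ ++ [y'] = w' :: m' :=
    List.exists_cons_of_ne_nil (by simp)
  refine h.ne_of_mem hz (y := w) (y' := w') (Lang_of_isInfix (applyM_isInfix f ⟨m, m', ?_⟩) hmem)
  have : y :: (l₁ ++ i :: j :: l₂) ++ [y'] = (y :: l₁) ++ i :: j :: (l₂ ++ [y']) := by simp
  rw [this, hw, hw']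
  simp

lemma not_one_two_of_isChain_applyM {x : Word} (h : (applyM (mR gam) x).IsChain Allowed) :
    x.IsChain fun i j => ¬(i = 1 ∧ j = 2) := by
  rw [List.isChain_iff_forall_rel_of_append_cons_cons]
  rintro i j l₁ l₂ rfl ⟨rfl, rfl⟩
  have hsplit : applyM (mR gam) (l₁ ++ 1 :: 2 :: l₂) =
      applyM (mR gam) l₁ ++ 2 :: 2 :: 0 :: applyM (mR gam) l₂ := by simp [mR, gam]
  exact (List.isChain_iff_forall_rel_of_append_cons_cons.1 h hsplit).1 rfl

lemma length_applyM_gamR_le (x : Word) : (applyM (mR gam) x).length ≤ 2 * x.length := by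
  induction x with
  | nil => simp
  | cons i x ih =>
    have : (mR gam i).length ≤ 2 := by fin_cases i <;> simp [mR, gam]
    simp
    omega

lemma exists_desubstitution {f : Sigma3 → Word} {s t q r : Word}
    (h : SquareExtending f s t q r) {z : InfWord} (hz : NoFiveHalves z)
    {x : Word} {n : ℕ} (hn : 2 * n + 4 ≤ x.length)
    (hx : x.IsChain fun i j => ¬(i = 1 ∧ j = 2)) (hmem : applyM f x ∈ Lang z) :
    ∃ x' : Word, n ≤ x'.length ∧ (x'.IsChain fun i j => ¬(i = 1 ∧ j = 2)) ∧
      applyM f (applyM (mR gam) x') ∈ Lang z := by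
  obtain ⟨y, x, rfl⟩ := List.exists_cons_of_ne_nil (l := x) (by rintro rfl; simp at hn)
  obtain ⟨x, y', rfl⟩ : ∃ m w, x = m ++ [w] :=
    ⟨_, _, (List.dropLast_append_getLast (l := x) (by rintro rfl; simp at hn)).symm⟩
  have hc := isChain_allowed_of_mem h hz hx hmem
  obtain ⟨d, x₁, hd, rfl, h0⟩ : ∃ d x₁, d.length ≤ 1 ∧ x = d ++ x₁ ∧ x₁.head? ≠ some 0 := by
    rcases x with _ | ⟨i, x⟩
    · exact ⟨[], [], by simp⟩
    · by_cases hi : i = 0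
      · refine ⟨[i], x, by simp, rfl, ?_⟩
        rcases x with _ | ⟨j, x⟩
        · simp
        · have := (List.isChain_cons_cons.1 hc).1.1
          rw [hi] at this
          simpa using this.symm
      · exact ⟨[], i :: x, by simp, rfl, by simpa using hi⟩
  obtain ⟨x', e, he, rfl⟩ := exists_applyM_of_isChain x₁
    (hc.infix (List.suffix_append _ _).isInfix) h0
  refine ⟨x', ?_, not_one_two_of_isChain_applyM (hc.infix ⟨d, e, by simp⟩),
    Lang_of_isInfix (applyM_isInfix f ⟨y :: d, e ++ [y'], by simp⟩) hmem⟩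
  have := length_applyM_gamR_le x'
  simp at hn
  omega

lemma exists_iterate_mem_Lang {z : InfWord} (hz : NoFiveHalves z) (n : ℕ) :
    ∀ (f : Sigma3 → Word) (s t q r : Word), SquareExtending f s t q r →
    (∀ m, ∃ x : Word, m ≤ x.length ∧ (x.IsChain fun i j => ¬(i = 1 ∧ j = 2)) ∧
      applyM f x ∈ Lang z) →
    ∃ i, applyM f ((applyM (mR gam))^[n] [i]) ∈ Lang z := by
  induction n with
  | zero =>
    intro f s t q r _ hx
    obtain ⟨x, hm, _, hmem⟩ := hx 1
    obtain ⟨i, x, rfl⟩ := List.exists_cons_of_ne_nil (l := x) (by rintro rfl; simp at hm)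
    exact ⟨i, Lang_of_isInfix (applyM_isInfix f ⟨[], x, rfl⟩) hmem⟩
  | succ n ih =>
    intro f s t q r h hx
    obtain ⟨i, hi⟩ := ih _ _ _ _ _ h.comp fun m => by
      obtain ⟨x, hm, hc, hmem⟩ := hx (2 * m + 4)
      obtain ⟨x', hm', hc', hmem'⟩ := exists_desubstitution h hz hm hc hmem
      exact ⟨x', hm', hc', by rwa [applyM_comp]⟩
    refine ⟨i, ?_⟩
    rwa [applyM_comp, ← Function.iterate_succ_apply' (applyM (mR gam))] at hi

lemma zero_infix_iterate_two (i : Sigma3) : [0] <:+: (applyM (mR gam))^[2] [i] := by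
  fin_cases i
  · exact ⟨[2, 1], [], rfl⟩
  · exact ⟨[2], [], rfl⟩
  · exact ⟨[2], [1, 0], rfl⟩

/-- Dual corollary: if `z` avoids exponents `≥ 5/2` and a final segment of `z` is `h(u)`
with `h = [a,b,c]`, `b` a suffix of `a`, `a` a suffix of `c`, `|b| ≥ |c|/2`, and `b, c`
sharing a common prefix `p` with `|p| ≥ |b|/2`, then `L(z)^R ⊇ L(h^R(G))`. -/
theorem stmt5 (z : InfWord) (hp : NoFiveHalves z)
    (a b c : Word) (ha : a ≠ []) (hb : b ≠ []) (hc : c ≠ [])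
    (u : InfWord) (k : ℕ) (hseg : shift z k = applyMInf ![a, b, c] u)
    (hba : b <:+ a) (hac : a <:+ c)
    (hlen : c.length ≤ 2 * b.length)
    (p : Word) (hpb : p <+: b) (hpc : p <+: c) (hp2 : b.length ≤ 2 * p.length) :
    Lang (applyMInf (mR ![a, b, c]) G) ⊆ List.reverse '' Lang z := by
  have hf : ∀ i, (![a, b, c] : Sigma3 → Word) i ≠ [] := by
    simp [Fin.forall_fin_succ, ha, hb, hc]
  have hbl := List.length_pos_of_ne_nil hb
  have hab := hba.length_le
  have hcl := hac.length_le
  have hext : SquareExtending ![a, b, c] b a [] p := by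
    refine ⟨hf, ?_, List.suffix_refl a, hac, fun _ => List.nil_prefix, hpb, hpc, ?_, ?_, ?_⟩
    · simp [Fin.forall_fin_succ, hba, hba.trans hac]
    · simp [Fin.forall_fin_succ, hcl, hab.trans hcl]
    · simpa using hlen
    · simp
      omega
  have hmem (n : ℕ) : applyM ![a, b, c] (prefixOf u n) ∈ Lang z :=
    Lang_shift (hseg ▸ applyM_prefixOf_mem_Lang hf u n)
  have hchain (m : ℕ) : ∃ x : Word, m ≤ x.length ∧ (x.IsChain fun i j => ¬(i = 1 ∧ j = 2)) ∧
      applyM ![a, b, c] x ∈ Lang z := by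
    have hu := hmem (m + 1)
    obtain ⟨y, x, hx⟩ := List.exists_cons_of_ne_nil (l := prefixOf u (m + 1))
      (List.ne_nil_of_length_pos (by simp))
    have hl := congrArg List.length hx
    rw [hx] at hu
    refine ⟨x, by simp at hl; omega, ?_, Lang_of_isInfix (applyM_isInfix _ ⟨[y], [], by simp⟩) hu⟩
    rw [List.isChain_iff_forall_rel_of_append_cons_cons]
    rintro i j l₁ l₂ rfl ⟨rfl, rfl⟩
    refine extended_square_not_mem_Lang hp hb List.nil_suffix hpb (by simpa using hp2)
      (Lang_of_isInfix ?_ hu)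
    obtain ⟨l, w, hw⟩ : ∃ l w, y :: l₁ = l ++ [w] :=
      ⟨_, _, (List.dropLast_append_getLast (List.cons_ne_nil y l₁)).symm⟩
    obtain ⟨d, hd⟩ := hext.suffix_all w
    obtain ⟨e, he⟩ := hpc
    rw [← List.cons_append, hw]
    refine ⟨applyM ![a, b, c] l ++ d, e ++ applyM ![a, b, c] l₂, ?_⟩
    have hc' : applyM ![a, b, c] (l ++ [w] ++ 1 :: 2 :: l₂) =
        applyM ![a, b, c] l ++ (d ++ b) ++ b ++ (p ++ e) ++ applyM ![a, b, c] l₂ := by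
      simp [hd, he]
    rw [hc']
    simp only [List.append_assoc, List.nil_append]
  intro v hv
  obtain ⟨n, hn⟩ := (isFactor_iff _ _).1 hv
  have hfR : ∀ i, mR ![a, b, c] i ≠ [] := fun i => by simpa [mR] using hf i
  have hv' := hn.trans ((prefixOf_applyMInf_isPrefix hfR G n).trans
    (applyM_isPrefix _ (prefixOf_G_isPrefix n))).isInfix
  refine ⟨v.reverse, Lang_of_isInfix (List.reverse_infix.2 hv') ?_, List.reverse_reverse v⟩
  rw [reverse_applyM, mR_mR, reverse_iterate_gam]
  obtain ⟨i, hi⟩ := exists_iterate_mem_Lang hp (n + 2) _ _ _ _ _ hext hchain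
  rw [Function.iterate_add_apply] at hi
  exact Lang_of_isInfix (applyM_isInfix _
    (iterate_applyM_isInfix _ n (zero_infix_iterate_two i))) hi
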